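/- arXiv:2506.18617 — 3 statements merged into one kernel-verified Lean document; each statement's English description precedes it below -/
import Mathlib

section
/- Let F₁ be a singular potential with constant Θ > 0 and let λ̄ ∈ (0,1). Then there exists a constant C ≥ 0 such that for every λ ∈ (0, λ̄] and every r ∈ ℝ, the Moreau–Yosida regularization satisfies F_{1,λ}(r) ≥ r²/(4λ̄) − C. -/
open Set Filter

/-- A singular potential with constant `Θ`: a function `F : ℝ → ℝ` (relevant on `[-1,1]`),
continuous on `[-1,1]`, twice continuously differentiable on `(-1,1)` with derivative `F'`
and second derivative `F''`, normalized by `F 0 = 0` and `F' 0 = 0`, with `F'' ≥ Θ` on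
`(-1,1)`, and whose derivative blows up to `+∞` at `1⁻` and to `-∞` at `(-1)⁺`. -/
structure SingularPotential (Θ : ℝ) : Type where
  F : ℝ → ℝ
  F' : ℝ → ℝ
  F'' : ℝ → ℝ
  contF : ContinuousOn F (Icc (-1) 1)
  hasDeriv : ∀ s ∈ Ioo (-1 : ℝ) 1, HasDerivAt F (F' s) s
  hasDeriv2 : ∀ s ∈ Ioo (-1 : ℝ) 1, HasDerivAt F' (F'' s) s
  contF'' : ContinuousOn F'' (Ioo (-1) 1)
  hF0 : F 0 = 0
  hF'0 : F' 0 = 0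
  hconv : ∀ s ∈ Ioo (-1 : ℝ) 1, Θ ≤ F'' s
  htop : Tendsto F' (nhdsWithin 1 (Iio 1)) atTop
  hbot : Tendsto F' (nhdsWithin (-1) (Ioi (-1))) atBot

/-- The Moreau–Yosida regularization of `F` with parameter `lam`. -/
noncomputable def moreauYosida (F : ℝ → ℝ) (lam : ℝ) (r : ℝ) : ℝ :=
  sInf ((fun s => 1 / (2 * lam) * (r - s) ^ 2 + F s) '' Icc (-1) 1)

/-- A potential bounded below by `m` on `[-1,1]` has Moreau–Yosida regularizations of quadratic
growth, uniformly in the parameter. -/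
theorem le_moreauYosida_of_lower_bound {F : ℝ → ℝ} {m lam lamBar : ℝ}
    (hF : ∀ s ∈ Icc (-1 : ℝ) 1, m ≤ F s) (hlam : 0 < lam) (hle : lam ≤ lamBar) (r : ℝ) :
    r ^ 2 / (4 * lamBar) - 1 / (2 * lamBar) + m ≤ moreauYosida F lam r := by
  refine le_csInf ((nonempty_Icc.2 (by norm_num)).image _) ?_
  rintro _ ⟨s, hs, rfl⟩
  have hBar : 0 < lamBar := hlam.trans_le hle
  have hsq : r ^ 2 / 2 - 1 ≤ (r - s) ^ 2 := by
    nlinarith [sq_nonneg (r - 2 * s), hs.1, hs.2]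
  calc r ^ 2 / (4 * lamBar) - 1 / (2 * lamBar) + m
      = 1 / (2 * lamBar) * (r ^ 2 / 2 - 1) + m := by field_simp; ring
    _ ≤ 1 / (2 * lamBar) * (r - s) ^ 2 + m := by gcongr
    _ ≤ 1 / (2 * lam) * (r - s) ^ 2 + F s := by gcongr; exact hF s hs

theorem moreauYosida_quadratic_growth (Θ lamBar : ℝ) (hΘ : 0 < Θ)
    (hlamBar : lamBar ∈ Ioo (0 : ℝ) 1) (P : SingularPotential Θ) :
    ∃ C : ℝ, 0 ≤ C ∧
      ∀ lam ∈ Ioc (0 : ℝ) lamBar, ∀ r : ℝ,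
        r ^ 2 / (4 * lamBar) - C ≤ moreauYosida P.F lam r := by
  obtain ⟨m, hm⟩ := isCompact_Icc.bddBelow_image P.contF
  have hBar : 0 < lamBar := hlamBar.1
  refine ⟨1 / (2 * lamBar) + |m|, by positivity, fun lam hlam r => ?_⟩
  have h := le_moreauYosida_of_lower_bound (fun s hs => hm (mem_image_of_mem P.F hs))
    hlam.1 hlam.2 r
  linarith [neg_abs_le m]
end

section
/- Let F₁ be a singular potential with constant Θ > 0. Then for every m̄ ∈ (0,1) there exist constants c₁ > 0 and c₃ ≥ 0 such that for all m ∈ [−m̄, m̄] and all s ∈ (−1,1): F₁'(s)·(s − m) ≥ c₁·|F₁'(s)| − c₃. -/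
open Set Filter

theorem SingularPotential.monotoneOn_F' {Θ : ℝ} (hΘ : 0 ≤ Θ) (P : SingularPotential Θ) :
    MonotoneOn P.F' (Ioo (-1) 1) := by
  refine monotoneOn_of_deriv_nonneg (convex_Ioo _ _)
    (fun s hs => (P.hasDeriv2 s hs).continuousAt.continuousWithinAt) ?_ ?_ <;>
    rw [interior_Ioo]
  · exact fun s hs => (P.hasDeriv2 s hs).differentiableAt.differentiableWithinAt
  · intro s hs
    rw [(P.hasDeriv2 s hs).deriv]
    exact hΘ.trans (P.hconv s hs)

theorem singular_potential_coercivity (Θ : ℝ) (hΘ : 0 < Θ) (P : SingularPotential Θ)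
    (mBar : ℝ) (hmBar : mBar ∈ Ioo (0 : ℝ) 1) :
    ∃ c₁ c₃ : ℝ, 0 < c₁ ∧ 0 ≤ c₃ ∧
      ∀ m ∈ Icc (-mBar) mBar, ∀ s ∈ Ioo (-1 : ℝ) 1,
        c₁ * |P.F' s| - c₃ ≤ P.F' s * (s - m) := by
  obtain ⟨h0, h1⟩ := hmBar
  have hmono := P.monotoneOn_F' hΘ.le
  have hP0 := P.hF'0
  obtain ⟨a, ha⟩ : ∃ a, a = (1 + mBar) / 2 := ⟨_, rfl⟩
  have haI : a ∈ Ioo (-1 : ℝ) 1 := ⟨by linarith, by linarith⟩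
  have hnaI : -a ∈ Ioo (-1 : ℝ) 1 := ⟨by linarith [haI.2], by linarith⟩
  have h0I : (0 : ℝ) ∈ Ioo (-1 : ℝ) 1 := by norm_num
  have hFa : 0 ≤ P.F' a := hP0 ▸ hmono h0I haI (by linarith)
  have hFna : P.F' (-a) ≤ 0 := hP0 ▸ hmono hnaI h0I (by linarith)
  obtain ⟨M, hM⟩ : ∃ M, M = P.F' a - P.F' (-a) := ⟨_, rfl⟩
  have hM0 : 0 ≤ M := by linarith
  have hc3 : 0 ≤ ((1 - mBar) / 2 + 2) * M := mul_nonneg (by linarith) hM0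
  refine ⟨(1 - mBar) / 2, ((1 - mBar) / 2 + 2) * M, by linarith, hc3, ?_⟩
  rintro m ⟨hm1, hm2⟩ s hs
  rcases le_total a s with has | has
  · have hF : 0 ≤ P.F' s := hFa.trans (hmono haI hs has)
    rw [abs_of_nonneg hF]
    have := mul_le_mul_of_nonneg_left (show (1 - mBar) / 2 ≤ s - m by linarith) hF
    linarith
  rcases le_total s (-a) with hsa | hsa
  · have hF : P.F' s ≤ 0 := (hmono hs hnaI hsa).trans hFna
    rw [abs_of_nonpos hF]
    have := mul_le_mul_of_nonpos_left (show s - m ≤ -((1 - mBar) / 2) by linarith) hF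
    linarith
  · have hF : |P.F' s| ≤ M := by
      rw [abs_le]
      constructor <;> linarith [hmono hs haI has, hmono hnaI hs hsa]
    have hsm : |s - m| ≤ 2 := by
      rw [abs_le]
      constructor <;> linarith [hs.1, hs.2]
    have hprod : |P.F' s * (s - m)| ≤ M * 2 := by
      rw [abs_mul]
      exact mul_le_mul hF hsm (abs_nonneg _) hM0
    have := mul_le_mul_of_nonneg_left hF (show 0 ≤ (1 - mBar) / 2 by linarith)
    linarith [(abs_le.mp hprod).1]
end

section
/- Let F₁ be a singular potential with constant Θ > 0. Then for every m̄ ∈ (0,1) there exist constants c₁ > 0 and c₃ ≥ 0, independent of λ, such that for all λ ∈ (0,1), all m ∈ [−m̄, m̄], and all s ∈ ℝ, the Yosida approximation satisfies F'_{1,λ}(s)·(s − m) ≥ c₁·|F'_{1,λ}(s)| − c₃. -/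
open Set Filter

theorem yosida_approx_coercivity (Θ : ℝ) (hΘ : 0 < Θ) (P : SingularPotential Θ)
    (J : ℝ → ℝ → ℝ)
    (hJmem : ∀ lam ∈ Ioo (0 : ℝ) 1, ∀ x, J lam x ∈ Ioo (-1 : ℝ) 1)
    (hJ : ∀ lam ∈ Ioo (0 : ℝ) 1, ∀ x, J lam x + lam * P.F' (J lam x) = x)
    (mBar : ℝ) (hmBar : mBar ∈ Ioo (0 : ℝ) 1) :
    ∃ c₁ c₃ : ℝ, 0 < c₁ ∧ 0 ≤ c₃ ∧
      ∀ lam ∈ Ioo (0 : ℝ) 1, ∀ m ∈ Icc (-mBar) mBar, ∀ s : ℝ,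
        c₁ * |(s - J lam s) / lam| - c₃ ≤ ((s - J lam s) / lam) * (s - m) := by
  obtain ⟨hm0, hm1⟩ := hmBar
  have hmono := P.monotoneOn_F' hΘ.le
  have h0mem : (0 : ℝ) ∈ Ioo (-1 : ℝ) 1 := by norm_num
  set a := (1 + mBar) / 2 with ha
  have hamem : a ∈ Ioo (-1 : ℝ) 1 := ⟨by linarith, by linarith⟩
  have hnamem : -a ∈ Ioo (-1 : ℝ) 1 := ⟨by linarith, by linarith⟩
  have hFa : 0 ≤ P.F' a := P.hF'0 ▸ hmono h0mem hamem (by linarith)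
  have hFna : P.F' (-a) ≤ 0 := P.hF'0 ▸ hmono hnamem h0mem (by linarith)
  refine ⟨(1 - mBar) / 2, 3 * (P.F' a - P.F' (-a)), by linarith, by linarith, ?_⟩
  rintro lam hlam m ⟨hml, hmu⟩ s
  have hj := hJmem lam hlam s
  have hs := hJ lam hlam s
  set j := J lam s
  set y := P.F' j with hy
  have hyosida : (s - j) / lam = y := by
    rw [div_eq_iff hlam.1.ne']
    linarith
  rw [hyosida]
  have hdrop : y * (j - m) ≤ y * (s - m) := by
    rw [← hs]
    nlinarith [mul_nonneg hlam.1.le (sq_nonneg y)]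
  refine le_trans ?_ hdrop
  rcases le_or_gt a j with h | h
  · have hy0 : 0 ≤ y := hFa.trans (hmono hamem hj h)
    rw [abs_of_nonneg hy0]
    nlinarith [mul_nonneg hy0 (show 0 ≤ j - m - (1 - mBar) / 2 by linarith)]
  rcases le_or_gt j (-a) with h' | h'
  · have hy0 : y ≤ 0 := (hmono hj hnamem h').trans hFna
    rw [abs_of_nonpos hy0]
    nlinarith [mul_nonneg (neg_nonneg.2 hy0) (show 0 ≤ m - j - (1 - mBar) / 2 by linarith)]
  · have hyu : y ≤ P.F' a := hmono hj hamem h.le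
    have hyl : P.F' (-a) ≤ y := hmono hnamem hj h'.le
    have hyabs : |y| ≤ P.F' a - P.F' (-a) := abs_le.2 ⟨by linarith, by linarith⟩
    have hjm : |j - m| ≤ 2 := abs_le.2 ⟨by linarith, by linarith⟩
    have hprod : -(|y| * 2) ≤ y * (j - m) := by
      refine le_trans ?_ (neg_abs_le _)
      rw [abs_mul]
      gcongr
    nlinarith [mul_nonneg (abs_nonneg y) (show 0 ≤ 1 - (1 - mBar) / 2 by linarith)]
end
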